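/- For every real x > 0, F(x) = ∫₀^∞ (1/(1−e^{−t}) − 1/t)·log(1−e^{−tx}) dt, and also F(x) = ∫₀¹ (1/(1−y) + 1/log y)·log(1−y^x)·dy/y. -/

import Mathlib

open Real MeasureTheory

/-- The digamma function ψ = Γ′/Γ. -/
noncomputable def digamma (x : ℝ) : ℝ := deriv Real.Gamma x / Real.Gamma x

/-- The Herglotz function F(x) = ∑_{n≥1} (ψ(nx) − log(nx))/n. -/
noncomputable def herglotzF (x : ℝ) : ℝ :=
  ∑' n : ℕ, (digamma (((n : ℝ) + 1) * x) - Real.log (((n : ℝ) + 1) * x)) / ((n : ℝ) + 1)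

open Set Filter Topology

/-- The kernel `1 / (1 - exp (-t)) - 1 / t` of Binet's integral for the digamma function. -/
noncomputable def binetKernel (t : ℝ) : ℝ := 1 / (1 - Real.exp (-t)) - 1 / t

lemma one_sub_exp_neg_pos {t : ℝ} (ht : 0 < t) : 0 < 1 - Real.exp (-t) := by
  have : Real.exp (-t) < 1 := Real.exp_lt_one_iff.2 (by linarith)
  linarith

lemma binetKernel_nonneg {t : ℝ} (ht : 0 < t) : 0 ≤ binetKernel t := by
  have h := one_sub_exp_neg_pos ht
  have h' := Real.add_one_le_exp (-t)
  exact sub_nonneg.2 (one_div_le_one_div_of_le h (by linarith))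

lemma binetKernel_le_one {t : ℝ} (ht : 0 < t) : binetKernel t ≤ 1 := by
  have h := one_sub_exp_neg_pos ht
  have h1 : (t + 1) * Real.exp (-t) ≤ 1 := by
    rw [Real.exp_neg, ← div_eq_mul_inv, div_le_one (Real.exp_pos t)]
    exact Real.add_one_le_exp t
  rw [binetKernel, sub_le_iff_le_add, div_le_iff₀ h]
  have h2 : (1 + 1 / t) * (1 - Real.exp (-t)) = 1 + (1 - (t + 1) * Real.exp (-t)) / t := by
    field_simp
    ring
  rw [h2]
  have : 0 ≤ (1 - (t + 1) * Real.exp (-t)) / t := div_nonneg (by linarith) ht.le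
  linarith

lemma measurable_binetKernel : Measurable binetKernel := by
  unfold binetKernel
  fun_prop

lemma norm_binetKernel_mul_exp_le {x t : ℝ} (ht : 0 < t) :
    ‖binetKernel t * Real.exp (-x * t)‖ ≤ Real.exp (-x * t) := by
  rw [norm_mul, Real.norm_of_nonneg (binetKernel_nonneg ht),
    Real.norm_of_nonneg (Real.exp_pos _).le]
  exact mul_le_of_le_one_left (Real.exp_pos _).le (binetKernel_le_one ht)

lemma integrableOn_binetKernel_mul_exp {x : ℝ} (hx : 0 < x) :
    IntegrableOn (fun t => binetKernel t * Real.exp (-x * t)) (Ioi 0) := by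
  refine (exp_neg_integrableOn_Ioi 0 hx).mono'
    (measurable_binetKernel.mul (by fun_prop)).aestronglyMeasurable ?_
  filter_upwards [ae_restrict_mem measurableSet_Ioi] with t ht
  exact norm_binetKernel_mul_exp_le ht

lemma integral_exp_neg_mul_Ioi_zero {x : ℝ} (hx : 0 < x) :
    ∫ t in Ioi (0 : ℝ), Real.exp (-x * t) = 1 / x := by
  rw [integral_exp_mul_Ioi (by linarith)]
  simp

lemma integral_norm_binetKernel_mul_exp_le {x : ℝ} (hx : 0 < x) :
    ∫ t in Ioi (0 : ℝ), ‖binetKernel t * Real.exp (-x * t)‖ ≤ 1 / x := by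
  rw [← integral_exp_neg_mul_Ioi_zero hx]
  exact setIntegral_mono_on (integrableOn_binetKernel_mul_exp hx).norm
    (exp_neg_integrableOn_Ioi 0 hx) measurableSet_Ioi fun t ht => norm_binetKernel_mul_exp_le ht

lemma integral_binetKernel_mul_exp_sub {x : ℝ} (hx : 0 < x) :
    (∫ t in Ioi (0 : ℝ), binetKernel t * Real.exp (-x * t)) -
      ∫ t in Ioi (0 : ℝ), binetKernel t * Real.exp (-(x + 1) * t) =
    1 / x - (Real.log (x + 1) - Real.log x) := by
  have hx1 : 0 < x + 1 := by linarith
  have hi := integrableOn_binetKernel_mul_exp hx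
  have hi1 := integrableOn_binetKernel_mul_exp hx1
  have hi2 : IntegrableOn (fun t => binetKernel t * Real.exp (-x * t) -
      binetKernel t * Real.exp (-(x + 1) * t)) (Ioi 0) := hi.sub hi1
  have he := exp_neg_integrableOn_Ioi 0 hx
  have hpt : EqOn (fun t : ℝ => Real.exp (-x * t) -
      (binetKernel t * Real.exp (-x * t) - binetKernel t * Real.exp (-(x + 1) * t)))
      (fun t => t⁻¹ • (Real.exp (-(x * t)) - Real.exp (-((x + 1) * t)))) (Ioi 0) := by
    intro t ht
    have h := (one_sub_exp_neg_pos ht).ne'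
    have ht' : t ≠ 0 := (mem_Ioi.1 ht).ne'
    have h1 : Real.exp (-(x + 1) * t) = Real.exp (-x * t) * Real.exp (-t) := by
      rw [← Real.exp_add]
      ring_nf
    simp only [binetKernel, smul_eq_mul, ← neg_mul, h1]
    field_simp
    ring
  have hfr := Frullani.integral_Ioi_eq (f := fun t : ℝ => Real.exp (-t)) (L := 1) (R := 0)
    ((by fun_prop : Continuous fun t : ℝ => Real.exp (-t)).locallyIntegrable.locallyIntegrableOn _)
    hx hx1
    (by
      have : Continuous fun t : ℝ => Real.exp (-t) := by fun_prop
      simpa using (this.tendsto 0).mono_left nhdsWithin_le_nhds)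
    Real.tendsto_exp_neg_atTop_nhds_zero
    ((he.sub hi2).congr_fun hpt measurableSet_Ioi)
  rw [← setIntegral_congr_fun measurableSet_Ioi hpt, integral_sub he hi2,
    integral_sub hi hi1, integral_exp_neg_mul_Ioi_zero hx, Real.log_div hx1.ne' hx.ne'] at hfr
  simp only [sub_zero, smul_eq_mul, mul_one] at hfr
  linarith

lemma tendsto_integral_binetKernel_mul_exp :
    Tendsto (fun x => ∫ t in Ioi (0 : ℝ), binetKernel t * Real.exp (-x * t)) atTop (𝓝 0) := by
  refine squeeze_zero_norm' ?_ (tendsto_const_nhds (x := (1 : ℝ)).div_atTop tendsto_id)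
  filter_upwards [eventually_gt_atTop 0] with x hx
  exact (norm_integral_le_integral_norm _).trans (integral_norm_binetKernel_mul_exp_le hx)

lemma differentiableAt_log_Gamma {x : ℝ} (hx : 0 < x) :
    DifferentiableAt ℝ (Real.log ∘ Real.Gamma) x := by
  refine (Real.differentiableAt_Gamma fun m => ?_).log (Real.Gamma_pos_of_pos hx).ne'
  have : (0 : ℝ) ≤ m := m.cast_nonneg
  linarith

lemma digamma_eq_deriv_log_Gamma {x : ℝ} (hx : 0 < x) :
    digamma x = deriv (Real.log ∘ Real.Gamma) x := by
  rw [Function.comp_def, deriv.log (Real.differentiableAt_Gamma fun m => ?_)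
    (Real.Gamma_pos_of_pos hx).ne', digamma]
  have : (0 : ℝ) ≤ m := m.cast_nonneg
  linarith

lemma log_Gamma_add_one {x : ℝ} (hx : 0 < x) :
    (Real.log ∘ Real.Gamma) (x + 1) = (Real.log ∘ Real.Gamma) x + Real.log x := by
  simp only [Function.comp_apply, Real.Gamma_add_one hx.ne',
    Real.log_mul hx.ne' (Real.Gamma_pos_of_pos hx).ne', add_comm]

lemma digamma_add_one {x : ℝ} (hx : 0 < x) : digamma (x + 1) = digamma x + 1 / x := by
  rw [digamma_eq_deriv_log_Gamma hx, digamma_eq_deriv_log_Gamma (by linarith),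
    ← deriv_comp_add_const, one_div, ← Real.deriv_log,
    ← deriv_add (differentiableAt_log_Gamma hx) (Real.differentiableAt_log hx.ne')]
  apply EventuallyEq.deriv_eq
  filter_upwards [eventually_gt_nhds hx] with y hy using log_Gamma_add_one hy

lemma digamma_le_log {x : ℝ} (hx : 0 < x) : digamma x ≤ Real.log x := by
  rw [digamma_eq_deriv_log_Gamma hx]
  refine (Real.convexOn_log_Gamma.deriv_le_slope (mem_Ioi.2 hx) (mem_Ioi.2 (by linarith))
    (lt_add_one x) (differentiableAt_log_Gamma hx)).trans_eq ?_
  rw [slope_def_field, log_Gamma_add_one hx]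
  simp

lemma log_sub_inv_le_digamma {x : ℝ} (hx : 0 < x) : Real.log x - 1 / x ≤ digamma x := by
  have h : Real.log x ≤ digamma (x + 1) := by
    rw [digamma_eq_deriv_log_Gamma (by linarith)]
    refine Eq.trans_le ?_ (Real.convexOn_log_Gamma.slope_le_deriv (mem_Ioi.2 hx)
      (mem_Ioi.2 (by linarith)) (lt_add_one x) (differentiableAt_log_Gamma (by linarith)))
    rw [slope_def_field, log_Gamma_add_one hx]
    simp
  linarith [digamma_add_one hx]

lemma tendsto_digamma_sub_log : Tendsto (fun x => digamma x - Real.log x) atTop (𝓝 0) := by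
  refine squeeze_zero_norm' ?_ (tendsto_const_nhds (x := (1 : ℝ)).div_atTop tendsto_id)
  filter_upwards [eventually_gt_atTop 0] with x hx
  rw [Real.norm_eq_abs, abs_le, id]
  have := digamma_le_log hx
  have := log_sub_inv_le_digamma hx
  have : 0 < 1 / x := by positivity
  constructor <;> linarith

/-- Binet's integral representation of the digamma function. -/
lemma digamma_sub_log_eq_integral {x : ℝ} (hx : 0 < x) :
    digamma x - Real.log x = -∫ t in Ioi (0 : ℝ), binetKernel t * Real.exp (-x * t) := by
  set d : ℝ → ℝ := fun y => digamma y - Real.log y +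
    ∫ t in Ioi (0 : ℝ), binetKernel t * Real.exp (-y * t) with hd
  have hper (n : ℕ) : d (x + n) = d x := by
    induction n with
    | zero => simp
    | succ n ih =>
      have hpos : 0 < x + n := by positivity
      rw [← ih, Nat.cast_succ, ← add_assoc]
      simp only [hd]
      linarith [digamma_add_one hpos, integral_binetKernel_mul_exp_sub hpos]
  have hlim : Tendsto d atTop (𝓝 0) := by
    simpa only [add_zero] using tendsto_digamma_sub_log.add tendsto_integral_binetKernel_mul_exp
  have hlim' : Tendsto (fun n : ℕ => d (x + n)) atTop (𝓝 0) :=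
    hlim.comp (tendsto_atTop_add_const_left _ _ tendsto_natCast_atTop_atTop)
  simp only [hper] at hlim'
  have : d x = 0 := tendsto_nhds_unique tendsto_const_nhds hlim'
  simp only [hd] at this
  linarith

lemma hasSum_neg_exp_div {s : ℝ} (hs : 0 < s) :
    HasSum (fun n : ℕ => -(Real.exp (-(((n : ℝ) + 1) * s)) / ((n : ℝ) + 1)))
      (Real.log (1 - Real.exp (-s))) := by
  have h : |Real.exp (-s)| < 1 := by
    rw [abs_of_pos (Real.exp_pos _)]
    exact Real.exp_lt_one_iff.2 (by linarith)
  have := (Real.hasSum_pow_div_log_of_abs_lt_one h).neg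
  rw [neg_neg] at this
  refine this.congr_fun fun n => ?_
  rw [← Real.exp_nat_mul]
  push_cast
  ring_nf

lemma herglotzF_eq_integral_Ioi {x : ℝ} (hx : 0 < x) :
    herglotzF x = ∫ t in Ioi (0 : ℝ), binetKernel t * Real.log (1 - Real.exp (-(t * x))) := by
  have hpos (n : ℕ) : 0 < ((n : ℝ) + 1) * x := by positivity
  have hsum := hasSum_integral_of_summable_integral_norm (μ := volume.restrict (Ioi (0 : ℝ)))
    (F := fun (n : ℕ) t =>
      -(1 / ((n : ℝ) + 1)) * (binetKernel t * Real.exp (-(((n : ℝ) + 1) * x) * t)))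
    (fun n => (integrableOn_binetKernel_mul_exp (hpos n)).const_mul _)
    (by
      have hs : Summable fun n : ℕ => 1 / x * (1 / ((n : ℝ) + 1) ^ 2) := by
        have := (summable_nat_add_iff 1).2 (Real.summable_one_div_nat_pow.2 one_lt_two)
        exact (by simpa using this : Summable fun n : ℕ => 1 / ((n : ℝ) + 1) ^ 2).mul_left _
      refine hs.of_nonneg_of_le (fun n => integral_nonneg fun t => norm_nonneg _) fun n => ?_
      simp only [norm_mul (-(1 / ((n : ℝ) + 1)))]
      rw [integral_const_mul, norm_neg, Real.norm_of_nonneg (by positivity)]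
      refine (mul_le_mul_of_nonneg_left (integral_norm_binetKernel_mul_exp_le (hpos n))
        (by positivity)).trans_eq ?_
      field_simp)
  have hterm (n : ℕ) : ∫ t in Ioi (0 : ℝ),
      -(1 / ((n : ℝ) + 1)) * (binetKernel t * Real.exp (-(((n : ℝ) + 1) * x) * t)) =
      (digamma (((n : ℝ) + 1) * x) - Real.log (((n : ℝ) + 1) * x)) / ((n : ℝ) + 1) := by
    rw [integral_const_mul, digamma_sub_log_eq_integral (hpos n)]
    ring
  simp only [hterm] at hsum
  rw [herglotzF, hsum.tsum_eq]
  refine setIntegral_congr_fun measurableSet_Ioi fun t ht => ?_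
  refine (((hasSum_neg_exp_div (mul_pos ht hx)).mul_left (binetKernel t)).congr_fun
    fun n => ?_).tsum_eq
  ring_nf

lemma image_exp_neg_Ioi_zero : (fun t : ℝ => Real.exp (-t)) '' Ioi 0 = Ioo 0 1 := by
  ext y
  constructor
  · rintro ⟨t, ht, rfl⟩
    exact ⟨Real.exp_pos _, Real.exp_lt_one_iff.2 (neg_lt_zero.2 ht)⟩
  · rintro ⟨h0, h1⟩
    exact ⟨-Real.log y, neg_pos.2 (Real.log_neg h0 h1), by simp [Real.exp_log h0]⟩

/-- Substitution `y = exp (-t)` in integrals over `Ioo 0 1`. -/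
lemma integral_Ioo_zero_one_eq_integral_exp_neg (g : ℝ → ℝ) :
    ∫ y in Ioo (0 : ℝ) 1, g y = ∫ t in Ioi (0 : ℝ), Real.exp (-t) * g (Real.exp (-t)) := by
  rw [← image_exp_neg_Ioi_zero]
  simpa using integral_image_eq_integral_abs_deriv_smul (measurableSet_Ioi (a := (0 : ℝ)))
    (fun t _ => (hasDerivAt_neg t).exp.hasDerivWithinAt)
    (fun a _ b _ hab => neg_injective (Real.exp_injective hab)) g

theorem herglotzF_integral_repr (x : ℝ) (hx : 0 < x) :
    (herglotzF x =
      ∫ t in Set.Ioi (0:ℝ),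
        (1 / (1 - Real.exp (-t)) - 1 / t) * Real.log (1 - Real.exp (-(t * x)))) ∧
    (herglotzF x =
      ∫ y in Set.Ioo (0:ℝ) 1,
        (1 / (1 - y) + 1 / Real.log y) * Real.log (1 - y ^ x) / y) := by
  refine ⟨herglotzF_eq_integral_Ioi hx, ?_⟩
  rw [herglotzF_eq_integral_Ioi hx, integral_Ioo_zero_one_eq_integral_exp_neg]
  refine setIntegral_congr_fun measurableSet_Ioi fun t _ => ?_
  simp only [binetKernel]
  rw [Real.log_exp, ← Real.exp_mul, neg_mul, mul_div_cancel₀ _ (Real.exp_pos _).ne',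
    div_neg, sub_eq_add_neg]
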